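/- arXiv:2103.05059 — 5 statements merged into one kernel-verified Lean document; each statement's English description precedes it below -/
import Mathlib

section
/- Let F be a cumulative distribution function in the maximum domain of attraction of H_ξ with ξ > 0; i.e., there exist constants a_n > 0 and b_n ∈ ℝ such that F(a_n x + b_n)^n → H_ξ(x) as n → ∞ for every x ∈ ℝ, where H_ξ(x) = exp(−(1+ξx)^{−1/ξ}) for 1+ξx > 0 and H_ξ(x) = 0 for x ≤ −1/ξ. Then there exists a positive function σ = σ(u) such that lim_{u→∞} sup_{0 ≤ y < ∞} |F_u(y) − G_{ξ,σ(u)}(y)| = 0. -/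
open MeasureTheory ProbabilityTheory Filter

/-- Excess distribution function of a cdf `F` above a threshold `u`. -/
noncomputable def excessCdf (F : ℝ → ℝ) (u y : ℝ) : ℝ := (F (y + u) - F u) / (1 - F u)

/-- Generalized Pareto distribution function with shape `ξ ≠ 0` and scale `σ`. -/
noncomputable def GPD (ξ σ y : ℝ) : ℝ := 1 - (1 + ξ * y / σ) ^ (-1 / ξ)

/-- The generalized extreme value distribution function `H_ξ` (for `ξ > 0`):
`H_ξ(x) = exp(-(1+ξx)^(-1/ξ))` when `1 + ξx > 0`, and `0` otherwise. -/
noncomputable def GEVD (ξ x : ℝ) : ℝ :=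
  if 0 < 1 + ξ * x then Real.exp (-(1 + ξ * x) ^ (-1 / ξ)) else 0

theorem tendsto_nat_mul_one_sub_of_pow {s : ℕ → ℝ} {t : ℝ} (h0 : ∀ n, 0 ≤ s n)
    (h : Tendsto (fun n => s n ^ n) atTop (nhds (Real.exp (-t)))) :
    Tendsto (fun n : ℕ => (n : ℝ) * (1 - s n)) atTop (nhds t) := by
  have hpos : ∀ᶠ n : ℕ in atTop, 0 < s n := by
    filter_upwards [h.eventually_const_lt (Real.exp_pos _), eventually_ge_atTop 1] with n hn hn1
    rcases (h0 n).lt_or_eq with h' | h'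
    · exact h'
    · rw [← h', zero_pow (by omega)] at hn
      exact absurd hn (lt_irrefl _)
  have hlog : Tendsto (fun n : ℕ => (n : ℝ) * Real.log (s n)) atTop (nhds (-t)) := by
    have := (Real.continuousAt_log (Real.exp_pos (-t)).ne').tendsto.comp h
    simpa [Function.comp_def, Real.log_pow] using this
  have hlog0 : Tendsto (fun n : ℕ => Real.log (s n)) atTop (nhds 0) := by
    have := hlog.mul (tendsto_inv_atTop_nhds_zero_nat (𝕜 := ℝ))
    rw [mul_zero] at this
    refine this.congr' ?_
    filter_upwards [eventually_ge_atTop 1] with n hn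
    have : (n : ℝ) ≠ 0 := by positivity
    field_simp
  have hs : Tendsto s atTop (nhds 1) := by
    have := (Real.continuous_exp.tendsto 0).comp hlog0
    rw [Real.exp_zero] at this
    refine this.congr' ?_
    filter_upwards [hpos] with n hn
    exact Real.exp_log hn
  have hlow := hs.mul hlog.neg
  rw [neg_neg, one_mul] at hlow
  have hup := hlog.neg
  rw [neg_neg] at hup
  refine tendsto_of_tendsto_of_tendsto_of_le_of_le' hlow hup ?_ ?_
  · filter_upwards [hpos] with n hn
    have h2 := Real.one_sub_inv_le_log_of_pos hn
    have h3 : s n * (1 - (s n)⁻¹) ≤ s n * Real.log (s n) := mul_le_mul_of_nonneg_left h2 hn.le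
    rw [mul_sub, mul_inv_cancel₀ hn.ne', mul_one] at h3
    nlinarith [Nat.cast_nonneg (α := ℝ) n]
  · filter_upwards [hpos] with n hn
    have h2 := Real.log_le_sub_one_of_pos hn
    nlinarith [Nat.cast_nonneg (α := ℝ) n]

/-- Antitone functions converging pointwise to a power on `(0, ∞)` converge continuously. -/
theorem tendsto_antitone_rpow_of_tendsto {f : ℕ → ℝ → ℝ} (hf : ∀ k, Antitone (f k)) {p : ℝ}
    (hlim : ∀ z, 0 < z → Tendsto (fun k => f k z) atTop (nhds (z ^ p)))
    {y : ℕ → ℝ} {z : ℝ} (hz : 0 < z) (hy : Tendsto y atTop (nhds z)) :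
    Tendsto (fun k => f k (y k)) atTop (nhds (z ^ p)) := by
  have hc : Tendsto (fun w : ℝ => w ^ p) (nhds z) (nhds (z ^ p)) :=
    Real.continuousAt_rpow_const z p (Or.inl hz.ne')
  refine tendsto_order.2 ⟨fun a ha => ?_, fun a ha => ?_⟩
  · obtain ⟨w, hw, hzw⟩ := (((hc.eventually_const_lt ha).filter_mono
      (nhdsWithin_le_nhds (s := Set.Ioi z))).and self_mem_nhdsWithin).exists
    have hzw : z < w := hzw
    filter_upwards [(hlim w (hz.trans hzw)).eventually_const_lt hw, hy.eventually_lt_const hzw]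
      with k h1 h2
    exact h1.trans_le (hf k h2.le)
  · obtain ⟨w, ⟨hw, hw0⟩, hzw⟩ := ((((hc.eventually_lt_const ha).and
      (lt_mem_nhds hz)).filter_mono
      (nhdsWithin_le_nhds (s := Set.Iio z))).and self_mem_nhdsWithin).exists
    have hzw : w < z := hzw
    filter_upwards [(hlim w hw0).eventually_lt_const hw, hy.eventually_const_lt hzw]
      with k h1 h2
    exact (hf k h2.le).trans_lt h1

/-- Converse of `tendsto_antitone_rpow_of_tendsto`: convergence of the values forces
convergence of the arguments. -/
theorem tendsto_of_tendsto_antitone_rpow {f : ℕ → ℝ → ℝ} (hf : ∀ k, Antitone (f k)) {p : ℝ}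
    (hp : p < 0) (hlim : ∀ z, 0 < z → Tendsto (fun k => f k z) atTop (nhds (z ^ p)))
    {y : ℕ → ℝ} {z : ℝ} (hz : 0 < z)
    (hy : Tendsto (fun k => f k (y k)) atTop (nhds (z ^ p))) :
    Tendsto y atTop (nhds z) := by
  refine tendsto_order.2 ⟨fun a ha => ?_, fun a ha => ?_⟩
  · obtain ⟨w, hw, hwz⟩ := exists_between (max_lt ha hz)
    have hw0 : 0 < w := (le_max_right a 0).trans_lt hw
    have hlt : z ^ p < w ^ p := Real.rpow_lt_rpow_of_neg hw0 hwz hp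
    filter_upwards [hy.eventually_lt (hlim w hw0) hlt] with k hk
    by_contra! h
    exact absurd (hf k (h.trans ((le_max_left a 0).trans hw.le))) (not_le.2 hk)
  · have hlt : a ^ p < z ^ p := Real.rpow_lt_rpow_of_neg hz ha hp
    filter_upwards [(hlim a (hz.trans ha)).eventually_lt hy hlt] with k hk
    by_contra! h
    exact absurd (hf k h) (not_le.2 hk)

/-- Nonnegative antitone functions converging pointwise to a negative power on `[1, ∞)`
converge uniformly there. -/
theorem eventually_forall_abs_sub_rpow_le {f : ℕ → ℝ → ℝ} (hf : ∀ k, Antitone (f k))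
    (hf0 : ∀ k z, 0 ≤ f k z) {p : ℝ} (hp : p < 0)
    (hlim : ∀ z, 1 ≤ z → Tendsto (fun k => f k z) atTop (nhds (z ^ p))) {ε : ℝ} (hε : 0 < ε) :
    ∀ᶠ k in atTop, ∀ z, 1 ≤ z → |f k z - z ^ p| ≤ ε := by
  obtain ⟨m, hm⟩ := exists_nat_one_div_lt (half_pos hε)
  set N : ℝ := (m : ℝ) + 1 with hN
  have hN0 : 0 < N := by positivity
  let x : ℕ → ℝ := fun i => ((i : ℝ) / N) ^ p⁻¹
  have hx : ∀ i : ℕ, x i ^ p = i / N := fun i =>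
    Real.rpow_inv_rpow (by positivity) hp.ne
  have hx1 : ∀ i ∈ Finset.Icc 1 (m + 1), 1 ≤ x i := by
    intro i hi
    rw [Finset.mem_Icc] at hi
    have h1 : (1 : ℝ) ≤ i := by exact_mod_cast hi.1
    have h2 : (i : ℝ) ≤ N := by rw [hN]; exact_mod_cast hi.2
    exact Real.one_le_rpow_of_pos_of_le_one_of_nonpos (by positivity)
      ((div_le_one hN0).2 h2) (inv_nonpos.2 hp.le)
  have hev : ∀ᶠ k in atTop, ∀ i ∈ Finset.Icc 1 (m + 1), |f k (x i) - i / N| < ε / 2 := by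
    rw [Filter.eventually_all_finset]
    intro i hi
    have := hlim _ (hx1 i hi)
    rw [hx] at this
    simpa [Real.dist_eq] using (Metric.tendsto_nhds.1 this) (ε / 2) (half_pos hε)
  filter_upwards [hev] with k hk z hz
  have hz0 : 0 < z := by linarith
  have ht0 : 0 < z ^ p := Real.rpow_pos_of_pos hz0 p
  have ht1 : z ^ p ≤ 1 := Real.rpow_le_one_of_one_le_of_nonpos hz hp.le
  have hzt : (z ^ p) ^ p⁻¹ = z := Real.rpow_rpow_inv hz0.le hp.ne
  obtain ⟨j, hj⟩ : ∃ j, ⌈z ^ p * N⌉₊ = j + 1 :=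
    Nat.exists_eq_succ_of_ne_zero (Nat.ceil_pos.2 (by positivity)).ne'
  have hle := Nat.le_ceil (z ^ p * N)
  have hgt := Nat.ceil_lt_add_one (a := z ^ p * N) (by positivity)
  have hjm : j + 1 ≤ m + 1 := by
    rw [← hj]
    apply Nat.ceil_le.2
    push_cast
    rw [← hN]
    nlinarith
  rw [hj] at hle hgt
  have hdiv : ((j + 1 : ℕ) : ℝ) / N = j / N + 1 / N := by push_cast; ring
  have hlow : (j : ℝ) / N ≤ z ^ p := by
    rw [div_le_iff₀ hN0]
    push_cast at hgt
    linarith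
  have hhigh : z ^ p ≤ ((j + 1 : ℕ) : ℝ) / N := by
    rwa [le_div_iff₀ hN0]
  have hub : f k z ≤ f k (x (j + 1)) := by
    apply hf k
    rw [← hzt]
    exact Real.rpow_le_rpow_of_nonpos ht0 hhigh (inv_nonpos.2 hp.le)
  have hu := abs_lt.1 (hk (j + 1) (Finset.mem_Icc.2 ⟨by omega, hjm⟩))
  rw [abs_le]
  refine ⟨?_, by linarith⟩
  rcases Nat.eq_zero_or_pos j with rfl | hjpos
  · have := hf0 k z
    simp only [CharP.cast_eq_zero, zero_div] at hdiv
    linarith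
  · have hl := abs_lt.1 (hk j (Finset.mem_Icc.2 ⟨hjpos, by omega⟩))
    have hlb : f k (x j) ≤ f k z := by
      apply hf k
      rw [← hzt]
      exact Real.rpow_le_rpow_of_nonpos (by positivity) hlow (inv_nonpos.2 hp.le)
    linarith

theorem tendsto_zero_of_contracting_recurrence {d r e : ℕ → ℝ} {q : ℝ} (hq1 : |q| < 1)
    (hr : Tendsto r atTop (nhds q)) (he : Tendsto e atTop (nhds 0))
    (h : ∀ k, d (k + 1) = r k * d k + e k) : Tendsto d atTop (nhds 0) := by
  obtain ⟨c, hqc, hc1⟩ := exists_between hq1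
  have hc0 : 0 ≤ c := (abs_nonneg q).trans hqc.le
  rw [Metric.tendsto_atTop]
  intro ε hε
  obtain ⟨K, hK⟩ := eventually_atTop.1 ((hr.abs.eventually_lt_const hqc).and
    ((by simpa using he.abs : Tendsto (fun k => |e k|) atTop (nhds 0)).eventually_lt_const
      (show (0 : ℝ) < (1 - c) * (ε / 2) by nlinarith)))
  have hind : ∀ j, |d (K + j)| ≤ c ^ j * |d K| + ε / 2 := by
    intro j
    induction j with
    | zero => simp; linarith
    | succ j ih =>
      obtain ⟨h1, h2⟩ := hK (K + j) (by omega)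
      have h3 : |d (K + (j + 1))| ≤ |r (K + j)| * |d (K + j)| + |e (K + j)| := by
        rw [← add_assoc, h, ← abs_mul]
        exact abs_add_le _ _
      have h4 : |r (K + j)| * |d (K + j)| ≤ c * (c ^ j * |d K| + ε / 2) := by gcongr
      rw [pow_succ]
      nlinarith
  have hpow : Tendsto (fun j => c ^ j * |d K|) atTop (nhds 0) := by
    simpa using (tendsto_pow_atTop_nhds_zero_of_lt_one hc0 hc1).mul_const |d K|
  obtain ⟨J, hJ⟩ := eventually_atTop.1 (hpow.eventually_lt_const (half_pos hε))
  refine ⟨K + J, fun n hn => ?_⟩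
  obtain ⟨j, rfl⟩ := Nat.exists_eq_add_of_le (show K ≤ n by omega)
  have h1 := hind j
  have h2 := hJ j (by omega)
  rw [Real.dist_eq, sub_zero]
  linarith

theorem tendsto_atTop_of_ratio_tendsto {A : ℕ → ℝ} {q : ℝ} (hA : ∀ k, 0 < A k) (hq : 1 < q)
    (h : Tendsto (fun k => A (k + 1) / A k) atTop (nhds q)) : Tendsto A atTop atTop := by
  obtain ⟨c, hc1, hcq⟩ := exists_between hq
  obtain ⟨K, hK⟩ := eventually_atTop.1 (h.eventually_const_lt hcq)
  refine (tendsto_add_atTop_iff_nat K).1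
    (tendsto_atTop_of_geom_le (c := c) (by simpa using hA K) hc1 fun n => ?_)
  have := (lt_div_iff₀ (hA (n + K))).1 (hK (n + K) (by omega))
  rw [show n + 1 + K = n + K + 1 by ring]
  exact this.le

/-- If an antitone tail converges to a power under affine normalization along a dyadic
sequence, then it does so under scaling alone, and the scales grow like powers. -/
theorem dyadic_scaling {S : ℝ → ℝ} (hS : Antitone S) {ξ : ℝ} (hξ : 0 < ξ) {A c : ℕ → ℝ}
    (hA : ∀ k, 0 < A k)
    (hlim : ∀ z, 0 < z → Tendsto (fun k : ℕ => 2 ^ k * S (A k * z + c k)) atTop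
      (nhds (z ^ (-1 / ξ)))) :
    Tendsto A atTop atTop ∧ Tendsto (fun k => A (k + 1) / A k) atTop (nhds (2 ^ ξ)) ∧
      ∀ z, 0 < z → Tendsto (fun k : ℕ => 2 ^ k * S (A k * z)) atTop (nhds (z ^ (-1 / ξ))) := by
  have hp : -1 / ξ < 0 := div_neg_of_neg_of_pos (by norm_num) hξ
  have hf : ∀ k : ℕ, Antitone fun z => 2 ^ k * S (A k * z + c k) := fun k x y hxy => by
    have := hS (add_le_add_left (mul_le_mul_of_nonneg_left hxy (hA k).le) (c k))
    exact mul_le_mul_of_nonneg_left this (by positivity)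
  have hstep : ∀ z, 0 < z →
      Tendsto (fun k => (A (k + 1) * z + c (k + 1) - c k) / A k) atTop (nhds (2 ^ ξ * z)) := by
    intro z hz
    have h2 : (0 : ℝ) < 2 ^ ξ := by positivity
    refine tendsto_of_tendsto_antitone_rpow hf hp hlim (by positivity) ?_
    have h1 := ((tendsto_add_atTop_iff_nat 1).2 (hlim z hz)).div_const 2
    have h3 : ((2 : ℝ) ^ ξ * z) ^ (-1 / ξ) = z ^ (-1 / ξ) / 2 := by
      rw [Real.mul_rpow h2.le hz.le, ← Real.rpow_mul (by norm_num),
        mul_div_cancel₀ _ hξ.ne', Real.rpow_neg_one]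
      ring
    rw [h3]
    refine h1.congr fun k => ?_
    have : A k * ((A (k + 1) * z + c (k + 1) - c k) / A k) + c k
        = A (k + 1) * z + c (k + 1) := by
      rw [mul_div_cancel₀ _ (hA k).ne']
      ring
    rw [this, pow_succ]
    ring
  have hratio : Tendsto (fun k => A (k + 1) / A k) atTop (nhds (2 ^ ξ)) := by
    have := (hstep 2 (by norm_num)).sub (hstep 1 one_pos)
    rw [show (2 : ℝ) ^ ξ * 2 - 2 ^ ξ * 1 = 2 ^ ξ by ring] at this
    refine this.congr fun k => ?_
    ring
  have hdiff : Tendsto (fun k => (c (k + 1) - c k) / A k) atTop (nhds 0) := by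
    have := (hstep 1 one_pos).sub hratio
    rw [show (2 : ℝ) ^ ξ * 1 - 2 ^ ξ = 0 by ring] at this
    refine this.congr fun k => ?_
    ring
  have hq : (1 : ℝ) < 2 ^ ξ := Real.one_lt_rpow (by norm_num) hξ
  have hd : Tendsto (fun k => c k / A k) atTop (nhds 0) := by
    have hr := hratio.inv₀ (by positivity)
    refine tendsto_zero_of_contracting_recurrence (q := ((2 : ℝ) ^ ξ)⁻¹) ?_ hr
      (by simpa using hr.mul hdiff) fun k => ?_
    · rw [abs_of_pos (by positivity)]
      exact inv_lt_one_of_one_lt₀ hq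
    · have h1 := (hA k).ne'
      have h2 := (hA (k + 1)).ne'
      field_simp
      ring
  refine ⟨tendsto_atTop_of_ratio_tendsto hA hq hratio, hratio, fun z hz => ?_⟩
  have hy : Tendsto (fun k => z - c k / A k) atTop (nhds z) := by
    simpa using tendsto_const_nhds.sub hd
  refine (tendsto_antitone_rpow_of_tendsto hf hlim hz hy).congr fun k => ?_
  have : A k * (z - c k / A k) + c k = A k * z := by
    rw [mul_sub, mul_div_cancel₀ _ (hA k).ne']
    ring
  simp only [this]

/-- Uniform regular variation of a tail with dyadic power scaling. -/
theorem eventually_forall_ratio_sub_rpow_le {S : ℝ → ℝ} (hS : Antitone S) (hS0 : ∀ x, 0 ≤ S x)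
    {p q : ℝ} (hp : p < 0) (hq : 0 < q) {A : ℕ → ℝ} (hA : ∀ k, 0 < A k)
    (hAtop : Tendsto A atTop atTop)
    (hratio : Tendsto (fun k => A (k + 1) / A k) atTop (nhds q))
    (hlim : ∀ z, 0 < z → Tendsto (fun k : ℕ => 2 ^ k * S (A k * z)) atTop (nhds (z ^ p)))
    {ε : ℝ} (hε : 0 < ε) :
    ∀ᶠ u in atTop, 0 < S u ∧ ∀ t, 1 ≤ t → |S (u * t) / S u - t ^ p| ≤ ε := by
  set M := q + 1 with hM
  have hM0 : 0 < M := by positivity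
  have hMp : 0 < M ^ p := Real.rpow_pos_of_pos hM0 p
  obtain ⟨δ, hδ0, hδ1, hδ2⟩ : ∃ δ > 0, δ ≤ M ^ p / 2 ∧ 2 * δ ≤ ε * (M ^ p / 2) :=
    ⟨min (M ^ p / 2) (ε * (M ^ p / 2) / 2), by positivity, min_le_left _ _, by
      linarith [min_le_right (M ^ p / 2) (ε * (M ^ p / 2) / 2)]⟩
  have hf : ∀ k : ℕ, Antitone fun z => 2 ^ k * S (A k * z) := fun k x y hxy =>
    mul_le_mul_of_nonneg_left (hS (mul_le_mul_of_nonneg_left hxy (hA k).le)) (by positivity)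
  obtain ⟨K, hK⟩ := eventually_atTop.1 ((eventually_forall_abs_sub_rpow_le hf
    (fun k z => mul_nonneg (by positivity) (hS0 _)) hp
    (fun z hz => hlim z (by linarith)) hδ0).and
    (hratio.eventually_lt_const (show q < M by linarith)))
  filter_upwards [eventually_ge_atTop (A K)] with u hu
  obtain ⟨k, hKk, hku, huk⟩ : ∃ k, K ≤ k ∧ A k ≤ u ∧ u < A (k + 1) := by
    by_contra! hcon
    have hall : ∀ j, A (K + j) ≤ u := by
      intro j
      induction j with
      | zero => exact hu
      | succ j ih => exact hcon (K + j) (by omega) ih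
    obtain ⟨n, hn, hKn⟩ := ((hAtop.eventually_gt_atTop u).and (eventually_ge_atTop K)).exists
    obtain ⟨j, rfl⟩ := Nat.exists_eq_add_of_le hKn
    exact absurd (hall j) (not_le.2 hn)
  obtain ⟨hunif, hrat⟩ := hK k hKk
  have hAk := hA k
  set z := u / A k with hz
  have hz1 : 1 ≤ z := (one_le_div hAk).2 hku
  have hzM : z ≤ M := ((div_le_div_iff_of_pos_right hAk).2 huk.le).trans hrat.le
  have huz : u = A k * z := (mul_div_cancel₀ _ hAk.ne').symm
  have hzp : M ^ p ≤ z ^ p := Real.rpow_le_rpow_of_nonpos (by linarith) hzM hp.le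
  have h1 := abs_le.1 (hunif z hz1)
  rw [← huz] at h1
  have hg : M ^ p / 2 ≤ 2 ^ k * S u := by linarith
  have h2k : (0 : ℝ) < 2 ^ k := by positivity
  have hSu : 0 < S u := pos_of_mul_pos_right (lt_of_lt_of_le (by positivity) hg) h2k.le
  refine ⟨hSu, fun t ht => ?_⟩
  have h2 := abs_le.1 (hunif (z * t) (by nlinarith))
  rw [Real.mul_rpow (by linarith) (by linarith), ← mul_assoc, ← huz] at h2
  have ht0 : 0 < t ^ p := Real.rpow_pos_of_pos (by linarith) p
  have ht1 : t ^ p ≤ 1 := Real.rpow_le_one_of_one_le_of_nonpos ht hp.le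
  have hnum : |2 ^ k * S (u * t) - t ^ p * (2 ^ k * S u)| ≤ 2 * δ := by
    rw [abs_le]
    constructor <;> nlinarith
  have heq : S (u * t) / S u - t ^ p
      = (2 ^ k * S (u * t) - t ^ p * (2 ^ k * S u)) / (2 ^ k * S u) := by
    field_simp
  rw [heq, abs_div, abs_of_pos (mul_pos h2k hSu), div_le_iff₀ (mul_pos h2k hSu)]
  calc _ ≤ 2 * δ := hnum
    _ ≤ ε * (M ^ p / 2) := hδ2
    _ ≤ _ := mul_le_mul_of_nonneg_left hg hε.le

/-- Pickands–Balkema–de Haan: if a cdf `F` is in the maximum domain of attraction of `H_ξ`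
with `ξ > 0`, then there is a positive scale function `σ(u)` such that the excess
distribution function above `u` converges to the GPD uniformly on `[0, ∞)` as `u → ∞`. -/
theorem pickands_balkema_deHaan
    (F : ℝ → ℝ) (hF_mono : Monotone F)
    (hF_bot : Tendsto F atBot (nhds 0)) (hF_top : Tendsto F atTop (nhds 1))
    (ξ : ℝ) (hξ : 0 < ξ)
    (a b : ℕ → ℝ) (ha : ∀ n, 0 < a n)
    (hMDA : ∀ x : ℝ, Tendsto (fun n => (F (a n * x + b n)) ^ n) atTop (nhds (GEVD ξ x))) :
    ∃ σ : ℝ → ℝ, (∀ u, 0 < σ u) ∧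
      Tendsto (fun u => ⨆ y : Set.Ici (0 : ℝ), |excessCdf F u ↑y - GPD ξ (σ u) ↑y|)
        atTop (nhds 0) := by
  have hF0 : ∀ x, 0 ≤ F x := fun x => hF_mono.le_of_tendsto hF_bot x
  have hF1 : ∀ x, F x ≤ 1 := fun x => hF_mono.ge_of_tendsto hF_top x
  have hS : Antitone fun x => 1 - F x := fun x y hxy => sub_le_sub_left (hF_mono hxy) 1
  have hlim : ∀ z, 0 < z → Tendsto (fun k : ℕ => 2 ^ k * (1 - F (a (2 ^ k) / ξ * z +
      (b (2 ^ k) - a (2 ^ k) / ξ)))) atTop (nhds (z ^ (-1 / ξ))) := by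
    intro z hz
    have hx : 1 + ξ * ((z - 1) / ξ) = z := by
      field_simp
      ring
    have h := hMDA ((z - 1) / ξ)
    rw [GEVD, hx, if_pos hz] at h
    have h1 := (tendsto_nat_mul_one_sub_of_pow (fun n => hF0 _) h).comp
      (tendsto_pow_atTop_atTop_of_one_lt (r := 2) (by norm_num))
    refine h1.congr fun k => ?_
    simp only [Function.comp_apply]
    push_cast
    congr 3
    ring_nf
  obtain ⟨hAtop, hratio, hscale⟩ := dyadic_scaling (A := fun k => a (2 ^ k) / ξ) hS hξ
    (fun k => div_pos (ha _) hξ) hlim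
  have hp : -1 / ξ < 0 := div_neg_of_neg_of_pos (by norm_num) hξ
  refine ⟨fun u => if 0 < u then ξ * u else 1, fun u => ?_, ?_⟩
  · dsimp only
    split_ifs with h <;> positivity
  · rw [Metric.tendsto_nhds]
    intro ε hε
    filter_upwards [eventually_gt_atTop 0, eventually_forall_ratio_sub_rpow_le hS
      (fun x => sub_nonneg.2 (hF1 x)) hp (by positivity) (fun k => div_pos (ha _) hξ) hAtop
      hratio hscale (half_pos hε)] with u hu ⟨hSu, hunif⟩
    rw [Real.dist_eq, sub_zero, abs_of_nonneg (Real.iSup_nonneg fun _ => abs_nonneg _)]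
    refine (Real.iSup_le (fun y => ?_) (half_pos hε).le).trans_lt (half_lt_self hε)
    obtain ⟨y, hy⟩ := y
    have hy : 0 ≤ y := hy
    have h := hunif (1 + y / u) (le_add_of_nonneg_right (by positivity))
    have hut : u * (1 + y / u) = y + u := by
      field_simp
      ring
    have hsc : 1 + ξ * y / (ξ * u) = 1 + y / u := by
      rw [mul_div_mul_left _ _ hξ.ne']
    rw [hut] at h
    rw [if_pos hu, excessCdf, GPD, hsc, abs_sub_comm]
    have hex : (F (y + u) - F u) / (1 - F u) = 1 - (1 - F (y + u)) / (1 - F u) := by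
      field_simp
      ring
    rw [hex, sub_sub_sub_cancel_left]
    exact h
end

section
/- Let X be an integrable random variable with continuous cdf F and let α ∈ (0,1). Then P(X ≥ VaR_α(X)) = 1−α and E[X · 1{X ≥ VaR_α(X)}]/(1−α) = (1/(1−α)) ∫_α^1 VaR_γ(X) dγ; that is, the conditional expectation of X given X ≥ VaR_α(X) equals the average of the quantiles VaR_γ(X) over γ ∈ (α,1). -/
open MeasureTheory ProbabilityTheory Filter

/-- Value-at-risk of a cdf `F` at level `α`: the generalized inverse `inf {x | α ≤ F x}`. -/
noncomputable def VaR (F : ℝ → ℝ) (α : ℝ) : ℝ := sInf {x : ℝ | α ≤ F x}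

/-- The generalized inverse of a continuous cdf satisfies the Galois property on `(0, 1)`. -/
theorem VaR_le_iff (μ : Measure ℝ) (hc : Continuous (cdf μ)) {γ : ℝ}
    (hγ : γ ∈ Set.Ioo (0 : ℝ) 1) (x : ℝ) : VaR (cdf μ) γ ≤ x ↔ γ ≤ cdf μ x := by
  have hne : {x : ℝ | γ ≤ cdf μ x}.Nonempty :=
    ((tendsto_cdf_atTop μ).eventually_const_le hγ.2).exists
  have hbdd : BddBelow {x : ℝ | γ ≤ cdf μ x} := by
    obtain ⟨b, hb⟩ := ((tendsto_cdf_atBot μ).eventually_lt_const hγ.1).exists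
    refine ⟨b, fun y hy => ?_⟩
    by_contra! hyb
    exact absurd (hy.trans (monotone_cdf μ hyb.le)) (not_le.2 hb)
  have hmem : γ ≤ cdf μ (VaR (cdf μ) γ) :=
    (isClosed_le continuous_const hc).csInf_mem hne hbdd
  exact ⟨fun h => hmem.trans (monotone_cdf μ h), fun h => csInf_le hbdd h⟩

theorem cdf_VaR (μ : Measure ℝ) (hc : Continuous (cdf μ)) {γ : ℝ}
    (hγ : γ ∈ Set.Ioo (0 : ℝ) 1) : cdf μ (VaR (cdf μ) γ) = γ := by
  refine le_antisymm ?_ ((VaR_le_iff μ hc hγ _).1 le_rfl)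
  refine le_of_tendsto (hc.continuousWithinAt (s := Set.Iio (VaR (cdf μ) γ))) ?_
  filter_upwards [self_mem_nhdsWithin] with y hy
  exact (not_le.1 fun h => (not_le.2 hy) ((VaR_le_iff μ hc hγ y).2 h)).le

theorem VaR_le_VaR_iff (μ : Measure ℝ) (hc : Continuous (cdf μ)) {α γ : ℝ}
    (hα : α ∈ Set.Ioo (0 : ℝ) 1) (hγ : γ ∈ Set.Ioo (0 : ℝ) 1) :
    VaR (cdf μ) α ≤ VaR (cdf μ) γ ↔ α ≤ γ := by
  rw [VaR_le_iff μ hc hα, cdf_VaR μ hc hγ]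

theorem aemeasurable_VaR (μ : Measure ℝ) (hc : Continuous (cdf μ)) :
    AEMeasurable (VaR (cdf μ)) (volume.restrict (Set.Ioo (0 : ℝ) 1)) :=
  aemeasurable_restrict_of_monotoneOn measurableSet_Ioo
    fun _ ha _ hb hab => (VaR_le_VaR_iff μ hc ha hb).2 hab

/-- The quantile function pushes the uniform law on `(0, 1)` forward to `μ`. -/
theorem map_VaR (μ : Measure ℝ) [IsProbabilityMeasure μ] (hc : Continuous (cdf μ)) :
    (volume.restrict (Set.Ioo (0 : ℝ) 1)).map (VaR (cdf μ)) = μ := by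
  refine Measure.ext_of_Iic _ _ fun x => ?_
  rw [Measure.map_apply_of_aemeasurable (aemeasurable_VaR μ hc) measurableSet_Iic,
    Measure.restrict_apply' measurableSet_Ioo, ← ofReal_cdf μ x]
  refine le_antisymm ?_ ?_
  · calc _ ≤ volume (Set.Ioc 0 (cdf μ x)) :=
          measure_mono fun γ hγ => ⟨hγ.2.1, (VaR_le_iff μ hc hγ.2 x).1 hγ.1⟩
      _ = _ := by rw [Real.volume_Ioc, sub_zero]
  · calc _ = volume (Set.Ioo 0 (cdf μ x)) := by rw [Real.volume_Ioo, sub_zero]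
      _ ≤ _ := measure_mono fun γ hγ =>
          have h : γ ∈ Set.Ioo (0 : ℝ) 1 := ⟨hγ.1, hγ.2.trans_le (cdf_le_one μ x)⟩
          Set.mem_inter ((VaR_le_iff μ hc h x).2 hγ.2.le) h

theorem preimage_VaR_Ici_inter (μ : Measure ℝ) (hc : Continuous (cdf μ)) {α : ℝ}
    (hα : α ∈ Set.Ioo (0 : ℝ) 1) :
    VaR (cdf μ) ⁻¹' Set.Ici (VaR (cdf μ) α) ∩ Set.Ioo 0 1 = Set.Ico α 1 := by
  ext γ
  constructor
  · rintro ⟨h, hγ⟩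
    exact ⟨(VaR_le_VaR_iff μ hc hα hγ).1 h, hγ.2⟩
  · intro h
    have hγ : γ ∈ Set.Ioo (0 : ℝ) 1 := ⟨hα.1.trans_le h.1, h.2⟩
    exact ⟨(VaR_le_VaR_iff μ hc hα hγ).2 h.1, hγ⟩

theorem measure_Ici_VaR (μ : Measure ℝ) [IsProbabilityMeasure μ] (hc : Continuous (cdf μ)) {α : ℝ}
    (hα : α ∈ Set.Ioo (0 : ℝ) 1) :
    μ (Set.Ici (VaR (cdf μ) α)) = ENNReal.ofReal (1 - α) := by
  rw [← Real.volume_Ico, ← preimage_VaR_Ici_inter μ hc hα,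
    ← Measure.restrict_apply' measurableSet_Ioo,
    ← Measure.map_apply_of_aemeasurable (aemeasurable_VaR μ hc) measurableSet_Ici, map_VaR μ hc]

theorem setIntegral_Ici_VaR (μ : Measure ℝ) [IsProbabilityMeasure μ] (hc : Continuous (cdf μ))
    {α : ℝ} (hα : α ∈ Set.Ioo (0 : ℝ) 1) :
    ∫ x in Set.Ici (VaR (cdf μ) α), x ∂μ = ∫ γ in Set.Ioo α 1, VaR (cdf μ) γ := by
  have h := setIntegral_map (measurableSet_Ici (a := VaR (cdf μ) α))
    aestronglyMeasurable_id (aemeasurable_VaR μ hc)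
  rw [map_VaR μ hc, Measure.restrict_restrict' measurableSet_Ioo,
    preimage_VaR_Ici_inter μ hc hα, integral_Ico_eq_integral_Ioo] at h
  exact h

/-- For an integrable random variable `X` with continuous cdf `F` and `α ∈ (0,1)`:
`P(X ≥ VaR_α(X)) = 1 - α`, and the conditional expectation of `X` given
`X ≥ VaR_α(X)`, i.e. `E[X · 1{X ≥ VaR_α(X)}]/(1-α)`, equals the average
`(1/(1-α)) ∫_α^1 VaR_γ(X) dγ` of the quantiles over `γ ∈ (α, 1)`. -/
theorem cvar_eq_average_quantiles
    {Ω : Type*} [MeasurableSpace Ω] (P : Measure Ω) [IsProbabilityMeasure P]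
    (X : Ω → ℝ) (hXm : Measurable X) (hXint : Integrable X P)
    (F : ℝ → ℝ) (hF : ∀ x, F x = (P {ω | X ω ≤ x}).toReal)
    (hFc : Continuous F)
    (α : ℝ) (hα : α ∈ Set.Ioo (0 : ℝ) 1) :
    (P {ω | VaR F α ≤ X ω}).toReal = 1 - α ∧
      (∫ ω in {ω | VaR F α ≤ X ω}, X ω ∂P) / (1 - α) =
        (1 / (1 - α)) * ∫ γ in Set.Ioo α 1, VaR F γ := by
  have : IsProbabilityMeasure (P.map X) := Measure.isProbabilityMeasure_map hXm.aemeasurable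
  obtain rfl : F = cdf (P.map X) := by
    ext x
    rw [hF, cdf_eq_real, measureReal_def, Measure.map_apply hXm measurableSet_Iic]
    rfl
  constructor
  · have h := measure_Ici_VaR (P.map X) hFc hα
    rw [Measure.map_apply hXm measurableSet_Ici] at h
    exact (congrArg ENNReal.toReal h).trans (ENNReal.toReal_ofReal (sub_nonneg.2 hα.2.le))
  · rw [← setIntegral_Ici_VaR (P.map X) hFc hα,
      setIntegral_map (f := fun x => x) measurableSet_Ici aestronglyMeasurable_id hXm.aemeasurable,
      div_eq_inv_mul, one_div]
    rfl
end

section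
/- Let X be a random variable with continuous cdf F, let u ∈ ℝ with 0 < F̄(u) < 1, let 0 < ξ < 1 and σ > 0, and suppose the excess distribution function satisfies F_u(y) = G_{ξ,σ}(y) for all y ≥ 0 (i.e., the tail above u is exactly generalized Pareto). Then for every α ∈ (F(u), 1), writing s_{u,α} = F̄(u)/(1−α): VaR_α(X) = u + (σ/ξ)(s_{u,α}^ξ − 1) and CVaR_α(X) = u + (σ/(1−ξ))(1 + (s_{u,α}^ξ − 1)/ξ). -/
open MeasureTheory ProbabilityTheory Filter

/-- Conditional value-at-risk at level `α` of a continuous cdf `F`,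
defined as the average of the quantiles of level `γ ∈ (α, 1)`. -/
noncomputable def CVaR (F : ℝ → ℝ) (α : ℝ) : ℝ :=
  (1 / (1 - α)) * ∫ γ in Set.Ioo α 1, VaR F γ

/-- If the excess distribution above `u` is generalized Pareto, then every quantile of level
above `F u` has the peaks-over-threshold closed form. -/
theorem VaR_eq_of_excessCdf_eq_GPD {F : ℝ → ℝ} (hmono : Monotone F) {u ξ σ : ℝ} (hξ : 0 < ξ)
    (hσ : 0 < σ) (htail : ∀ y : ℝ, 0 ≤ y → excessCdf F u y = GPD ξ σ y)
    {α : ℝ} (hα : α ∈ Set.Ioo (F u) 1) :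
    VaR F α = u + (σ / ξ) * (((1 - F u) / (1 - α)) ^ ξ - 1) := by
  obtain ⟨hα₀, hα₁⟩ := hα
  have hb : 0 < 1 - F u := by linarith
  have ha : 0 < 1 - α := by linarith
  have hs : 1 ≤ ((1 - F u) / (1 - α)) ^ ξ :=
    Real.one_le_rpow ((one_le_div ha).2 (by linarith)) hξ.le
  suffices h : {x : ℝ | α ≤ F x} =
      Set.Ici (u + (σ / ξ) * (((1 - F u) / (1 - α)) ^ ξ - 1)) by
    rw [VaR, h, csInf_Ici]
  ext x
  simp only [Set.mem_ofPred_eq, Set.mem_Ici]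
  rcases lt_or_ge x u with hx | hx
  · have h₁ : F x ≤ F u := hmono hx.le
    have h₂ : 0 ≤ (σ / ξ) * (((1 - F u) / (1 - α)) ^ ξ - 1) :=
      mul_nonneg (by positivity) (by linarith)
    constructor <;> intro <;> linarith
  · have hF := htail (x - u) (by linarith)
    have ht : 0 < 1 + ξ * (x - u) / σ := by
      have : 0 ≤ ξ * (x - u) / σ :=
        div_nonneg (mul_nonneg hξ.le (by linarith)) hσ.le
      linarith
    rw [excessCdf, GPD, sub_add_cancel, div_eq_iff hb.ne', neg_div, one_div,
      Real.rpow_neg ht.le] at hF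
    have hpow : 0 < (1 + ξ * (x - u) / σ) ^ ξ⁻¹ := Real.rpow_pos_of_pos ht _
    calc α ≤ F x
        ↔ (1 - F u) * ((1 + ξ * (x - u) / σ) ^ ξ⁻¹)⁻¹ ≤ 1 - α := by
          constructor <;> intro <;> linarith
      _ ↔ (1 - F u) / (1 - α) ≤ (1 + ξ * (x - u) / σ) ^ ξ⁻¹ := by
          rw [← div_eq_mul_inv, div_le_iff₀ hpow, div_le_iff₀ ha, mul_comm]
      _ ↔ ((1 - F u) / (1 - α)) ^ ξ ≤ 1 + ξ * (x - u) / σ :=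
          Real.le_rpow_inv_iff_of_pos (by positivity) ht.le hξ
      _ ↔ u + (σ / ξ) * (((1 - F u) / (1 - α)) ^ ξ - 1) ≤ x := by
          rw [← sub_le_iff_le_add', le_div_iff₀ hσ, ← le_sub_iff_add_le', div_mul_eq_mul_div,
            div_le_iff₀ hξ, mul_comm σ, mul_comm ξ]

theorem div_one_sub_rpow {b γ ξ : ℝ} (hb : 0 ≤ b) (hγ : γ ≤ 1) :
    (b / (1 - γ)) ^ ξ = b ^ ξ * (1 - γ) ^ (-ξ) := by
  rw [Real.div_rpow hb (by linarith), Real.rpow_neg (by linarith), div_eq_mul_inv]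

theorem intervalIntegrable_div_one_sub_rpow {α b ξ : ℝ} (hα : α ≤ 1) (hb : 0 ≤ b) (hξ : ξ < 1) :
    IntervalIntegrable (fun γ : ℝ => (b / (1 - γ)) ^ ξ) volume α 1 := by
  have h : IntervalIntegrable (fun x : ℝ => x ^ (-ξ)) volume (1 - α) (1 - 1) :=
    intervalIntegral.intervalIntegrable_rpow' (by linarith)
  have h' := (h.comp_sub_left 1).const_mul (b ^ ξ)
  simp only [sub_sub_cancel] at h'
  refine h'.congr fun γ hγ => ?_
  rw [Set.uIoc_of_le hα] at hγ
  exact (div_one_sub_rpow hb hγ.2).symm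

theorem integral_div_one_sub_rpow {α b ξ : ℝ} (hα : α < 1) (hb : 0 ≤ b) (hξ : ξ < 1) :
    ∫ γ in α..1, (b / (1 - γ)) ^ ξ = (1 - α) * (b / (1 - α)) ^ ξ / (1 - ξ) := by
  have hcongr : ∫ γ in α..1, (b / (1 - γ)) ^ ξ = ∫ γ in α..1, b ^ ξ * (1 - γ) ^ (-ξ) := by
    refine intervalIntegral.integral_congr fun γ hγ => ?_
    rw [Set.uIcc_of_le hα.le] at hγ
    exact div_one_sub_rpow hb hγ.2
  rw [hcongr, intervalIntegral.integral_const_mul,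
    intervalIntegral.integral_comp_sub_left (fun x : ℝ => x ^ (-ξ)) 1, sub_self,
    integral_rpow (Or.inl (by linarith)), Real.zero_rpow (by linarith),
    div_one_sub_rpow hb hα.le, Real.rpow_add_one (by linarith)]
  ring

/-- POT formulas are exact for an exact GPD tail: if the excess distribution of `X`
above `u` is exactly `G_{ξ,σ}` with `0 < ξ < 1`, `σ > 0`, and `0 < F̄(u) < 1`, then for
every `α ∈ (F(u), 1)`, writing `s = F̄(u)/(1-α)`,
`VaR_α(X) = u + (σ/ξ)(s^ξ - 1)` and `CVaR_α(X) = u + (σ/(1-ξ))(1 + (s^ξ - 1)/ξ)`. -/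
theorem pot_formulas_exact_gpd_tail
    {Ω : Type*} [MeasurableSpace Ω] (P : Measure Ω) [IsProbabilityMeasure P]
    (X : Ω → ℝ) (hXm : Measurable X)
    (F : ℝ → ℝ) (hF : ∀ x, F x = (P {ω | X ω ≤ x}).toReal)
    (hFc : Continuous F)
    (u ξ σ : ℝ) (hξ : ξ ∈ Set.Ioo (0 : ℝ) 1) (hσ : 0 < σ)
    (hFu : 0 < 1 - F u) (hFu' : 1 - F u < 1)
    (htail : ∀ y : ℝ, 0 ≤ y → excessCdf F u y = GPD ξ σ y) :
    ∀ α ∈ Set.Ioo (F u) 1,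
      VaR F α = u + (σ / ξ) * (((1 - F u) / (1 - α)) ^ ξ - 1) ∧
      CVaR F α = u + (σ / (1 - ξ)) * (1 + (((1 - F u) / (1 - α)) ^ ξ - 1) / ξ) := by
  have hmono : Monotone F := fun x y hxy => by
    rw [hF, hF]
    exact measureReal_mono fun ω (hω : X ω ≤ x) => hω.trans hxy
  obtain ⟨hξ₀, hξ₁⟩ := hξ
  intro α hα
  refine ⟨VaR_eq_of_excessCdf_eq_GPD hmono hξ₀ hσ htail hα, ?_⟩
  have ha : 0 < 1 - α := by linarith [hα.2]
  have hξ' : 0 < 1 - ξ := by linarith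
  have hVaR : ∫ γ in Set.Ioo α 1, VaR F γ =
      ∫ γ in Set.Ioo α 1, (u + (σ / ξ) * (((1 - F u) / (1 - γ)) ^ ξ - 1)) :=
    setIntegral_congr_fun measurableSet_Ioo fun γ hγ =>
      VaR_eq_of_excessCdf_eq_GPD hmono hξ₀ hσ htail ⟨hα.1.trans hγ.1, hγ.2⟩
  have hint := intervalIntegrable_div_one_sub_rpow hα.2.le hFu.le hξ₁
  rw [CVaR, hVaR, ← integral_Ioc_eq_integral_Ioo, ← intervalIntegral.integral_of_le hα.2.le,
    intervalIntegral.integral_add intervalIntegrable_const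
      ((hint.sub intervalIntegrable_const).const_mul _),
    intervalIntegral.integral_const_mul, intervalIntegral.integral_sub hint
      intervalIntegrable_const, integral_div_one_sub_rpow hα.2 hFu.le hξ₁]
  simp only [intervalIntegral.integral_const, smul_eq_mul]
  field_simp
  ring
end

section
/- Theorem (asymptotic normality of the unbiased POT CVaR estimator). Let k_n → ∞, let a_n > 0, A_n ≠ 0 be real sequences with √(k_n) A_n → λ ∈ ℝ, let β > 1, 0 < ξ < 1, ρ ≤ 0, V > 0 and let c_n, c_{u,n}, ε_n be real random variables with ε_n = c_{u,n} − c_n. Suppose: (i) (√(k_n)/a_n)(ĉ_n − c_{u,n}) →d N(0, V) for random variables ĉ_n; (ii) ε_n/(a_n A_n) →p K_{ξ,ρ}(β); (iii) σ̂_n/a_n →p 1 for positive random variables σ̂_n; (iv) Â_n/A_n →p 1; (v) K̂_n →p K_{ξ,ρ}(β); (vi) V̂_n →p V for positive random variables V̂_n. Define ε̂_n = σ̂_n Â_n K̂_n and ĉ_{ε,n} = ĉ_n − ε̂_n. Then √(k_n)(ĉ_{ε,n} − c_n)/(σ̂_n √(V̂_n)) →d N(0, 1). -/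
open MeasureTheory ProbabilityTheory Filter

/-- The function `K_{ξ,ρ}`. -/
noncomputable def Kfun (ξ ρ β : ℝ) : ℝ :=
  if ρ = 0 then (β ^ ξ / (ξ * (1 - ξ))) * ((1 - 2 * ξ) / (ξ * (1 - ξ)) - Real.log β) + 1 / ξ ^ 2
  else if ξ + ρ = 0 then (1 / ρ) * (β ^ ξ / (ξ * (1 - ξ)) - Real.log β + (ξ - 1) / ξ)
  else (1 / ρ) * (β ^ ξ / (ξ * (1 - ξ)) - (1 / (ξ + ρ)) * (β ^ (ξ + ρ) / (1 - ξ - ρ) + ρ / ξ))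

/-- Convergence in distribution to a (real) Gaussian with mean `m` and variance `v`,
expressed through pointwise convergence of the cdfs (the Gaussian cdf is continuous,
so this is equivalent to weak convergence). -/
def TendstoInDistGaussian {Ω : Type*} [MeasurableSpace Ω] (P : Measure Ω)
    (T : ℕ → Ω → ℝ) (m v : ℝ) : Prop :=
  ∀ x : ℝ, Tendsto (fun n => (P {ω | T n ω ≤ x}).toReal) atTop
    (nhds ((gaussianReal m v.toNNReal (Set.Iic x)).toReal))

/-- Convergence in probability to a constant `c`. -/
def TendstoInProb {Ω : Type*} [MeasurableSpace Ω] (P : Measure Ω)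
    (T : ℕ → Ω → ℝ) (c : ℝ) : Prop :=
  ∀ ε > 0, Tendsto (fun n => (P {ω | ε ≤ |T n ω - c|}).toReal) atTop (nhds 0)

open scoped Topology

/-- Sets in `ℕ × Ω` whose `n`-th section has probability tending to one, in the sense that the
(outer) measure of its complement vanishes. Convergence in probability is convergence along this
filter. -/
def probFilter {Ω : Type*} [MeasurableSpace Ω] (P : Measure Ω) : Filter (ℕ × Ω) where
  sets := {s | Tendsto (fun n => P {ω | (n, ω) ∉ s}) atTop (𝓝 0)}
  univ_sets := by simp
  sets_of_superset {s t} hs hst := by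
    refine tendsto_of_tendsto_of_tendsto_of_le_of_le tendsto_const_nhds hs
      (fun _ => zero_le) fun n => measure_mono fun ω hω h => hω (hst h)
  inter_sets {s t} hs ht := by
    have hsum := Tendsto.add (show Tendsto _ _ _ from hs) (show Tendsto _ _ _ from ht)
    rw [add_zero] at hsum
    refine tendsto_of_tendsto_of_tendsto_of_le_of_le tendsto_const_nhds hsum
      (fun _ => zero_le) fun n => (measure_mono fun ω hω => ?_).trans (measure_union_le _ _)
    by_contra h
    simp_all

lemma mem_probFilter {Ω : Type*} [MeasurableSpace Ω] {P : Measure Ω} {s : Set (ℕ × Ω)} :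
    s ∈ probFilter P ↔ Tendsto (fun n => P {ω | (n, ω) ∉ s}) atTop (𝓝 0) :=
  Iff.rfl

lemma tendsto_fst_probFilter {Ω : Type*} [MeasurableSpace Ω] (P : Measure Ω) :
    Tendsto Prod.fst (probFilter P) atTop := by
  intro s hs
  rw [Filter.mem_map, mem_probFilter]
  refine tendsto_const_nhds.congr' ?_
  filter_upwards [hs] with n hn
  simp [hn]

lemma TendstoInProb.tendsto_probFilter {Ω : Type*} [MeasurableSpace Ω] {P : Measure Ω}
    [IsFiniteMeasure P] {T : ℕ → Ω → ℝ} {c : ℝ} (h : TendstoInProb P T c) :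
    Tendsto (fun p : ℕ × Ω => T p.1 p.2) (probFilter P) (𝓝 c) := by
  rw [Metric.tendsto_nhds]
  intro δ hδ
  have h' := (ENNReal.tendsto_toReal_iff (fun _ => measure_ne_top P _) ENNReal.zero_ne_top).1
    (by simpa using h δ hδ)
  simpa [Filter.Eventually, mem_probFilter, Real.dist_eq] using h'

lemma continuous_gaussianReal_Iic {m : ℝ} {v : NNReal} (hv : v ≠ 0) :
    Continuous fun x => (gaussianReal m v (Set.Iic x)).toReal := by
  have := nullSingletonClass_gaussianReal (μ := m) hv
  have hcdf : (fun x => (gaussianReal m v (Set.Iic x)).toReal) = cdf (gaussianReal m v) :=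
    funext fun x => (cdf_eq_real _ x).symm
  rw [hcdf, continuous_iff_continuousAt]
  intro x
  have hmono := monotone_cdf (gaussianReal m v)
  have hatom : (cdf (gaussianReal m v)).measure {x} = 0 := by simp [measure_cdf]
  rw [StieltjesFunction.measure_singleton, ENNReal.ofReal_eq_zero, sub_nonpos] at hatom
  refine continuousAt_iff_continuous_left'_right'.2 ⟨?_, ?_⟩
  · exact hmono.continuousWithinAt_Iio_iff_leftLim_eq.2
      (le_antisymm (hmono.leftLim_le le_rfl) hatom)
  · exact ((cdf (gaussianReal m v)).right_continuous x).mono Set.Ioi_subset_Ici_self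

lemma gaussianReal_Iic_sqrt_mul {V : ℝ} (hV : 0 < V) (x : ℝ) :
    gaussianReal 0 V.toNNReal (Set.Iic (√V * x)) = gaussianReal 0 (1 : ℝ).toNNReal (Set.Iic x) := by
  have hs : 0 < √V := Real.sqrt_pos.2 hV
  have hmap : (gaussianReal 0 1).map (√V * ·) = gaussianReal 0 V.toNNReal := by
    rw [gaussianReal_map_const_mul, mul_zero, mul_one]
    congr 1
    ext
    simp [Real.sq_sqrt hV.le, hV.le]
  rw [← hmap, Measure.map_apply (by fun_prop) measurableSet_Iic, Real.toNNReal_one]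
  congr 1
  ext y
  exact mul_le_mul_iff_of_pos_left hs

/-- Slutsky-type statement: a random threshold converging in probability may be replaced by its
limit in the limiting distribution function. No measurability is required. -/
lemma tendsto_measure_le_of_tendsto_probFilter {Ω : Type*} [MeasurableSpace Ω] {P : Measure Ω}
    [IsFiniteMeasure P] {X Y : ℕ → Ω → ℝ} {F : ℝ → ℝ} {y : ℝ}
    (hX : ∀ x, Tendsto (fun n => (P {ω | X n ω ≤ x}).toReal) atTop (𝓝 (F x)))
    (hF : ContinuousAt F y)
    (hY : Tendsto (fun p : ℕ × Ω => Y p.1 p.2) (probFilter P) (𝓝 y)) :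
    Tendsto (fun n => (P {ω | X n ω ≤ Y n ω}).toReal) atTop (𝓝 (F y)) := by
  have bad : ∀ δ > 0, Tendsto (fun n => P.real {ω | δ ≤ |Y n ω - y|}) atTop (𝓝 0) := by
    intro δ hδ
    have h := mem_probFilter.1 (Metric.tendsto_nhds.1 hY δ hδ)
    have h' := (ENNReal.tendsto_toReal_iff (fun _ => measure_ne_top P _) ENNReal.zero_ne_top).2 h
    simpa [Real.dist_eq, Measure.real] using h'
  rw [tendsto_order]
  constructor
  · intro b hb
    obtain ⟨δ, hδ, hball⟩ := Metric.eventually_nhds_iff.1 (hF.eventually (lt_mem_nhds hb))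
    have hb' : b < F (y - δ / 2) := hball (by simp [abs_of_pos hδ, hδ])
    have hlim := (hX (y - δ / 2)).sub (bad (δ / 2) (half_pos hδ))
    rw [sub_zero] at hlim
    filter_upwards [hlim.eventually (lt_mem_nhds hb')] with n hn
    refine hn.trans_le (sub_le_iff_le_add.2 ?_)
    refine (measureReal_mono (μ := P) fun ω hω => ?_).trans (measureReal_union_le _ _)
    simp only [Set.mem_union, Set.mem_ofPred_eq] at hω ⊢
    by_contra! h
    linarith [(abs_lt.1 h.2).1, h.1]
  · intro b hb
    obtain ⟨δ, hδ, hball⟩ := Metric.eventually_nhds_iff.1 (hF.eventually (gt_mem_nhds hb))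
    have hb' : F (y + δ / 2) < b := hball (by simp [abs_of_pos hδ, hδ])
    have hlim := (hX (y + δ / 2)).add (bad (δ / 2) (half_pos hδ))
    rw [add_zero] at hlim
    filter_upwards [hlim.eventually (gt_mem_nhds hb')] with n hn
    refine lt_of_le_of_lt ?_ hn
    refine (measureReal_mono (μ := P) fun ω hω => ?_).trans (measureReal_union_le _ _)
    simp only [Set.mem_union, Set.mem_ofPred_eq] at hω ⊢
    by_contra! h
    linarith [(abs_lt.1 h.2).2, h.1]

/-- Asymptotic normality of the unbiased POT CVaR estimator
`ĉ_{ε,n} = ĉ_n - ε̂_n` with `ε̂_n = σ̂_n Â_n K̂_n`: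
`√k(ĉ_{ε,n} - c_n)/(σ̂_n √V̂_n) →d N(0, 1)`. -/
theorem unbiased_pot_cvar_asymptotic_normality
    {Ω : Type*} [MeasurableSpace Ω] (P : Measure Ω) [IsProbabilityMeasure P]
    (k : ℕ → ℕ) (hk : Tendsto k atTop atTop)
    (a A : ℕ → ℝ) (ha : ∀ n, 0 < a n) (hA : ∀ n, A n ≠ 0)
    (lam : ℝ) (hlam : Tendsto (fun n => Real.sqrt (k n) * A n) atTop (nhds lam))
    (β ξ ρ : ℝ) (hβ : 1 < β) (hξ0 : 0 < ξ) (hξ1 : ξ < 1) (hρ : ρ ≤ 0)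
    (V : ℝ) (hV : 0 < V)
    (c cu eps : ℕ → Ω → ℝ) (heps : ∀ n ω, eps n ω = cu n ω - c n ω)
    (chat : ℕ → Ω → ℝ)
    (h1 : TendstoInDistGaussian P
      (fun n ω => Real.sqrt (k n) / a n * (chat n ω - cu n ω)) 0 V)
    (h2 : TendstoInProb P (fun n ω => eps n ω / (a n * A n)) (Kfun ξ ρ β))
    (σhat : ℕ → Ω → ℝ) (hσpos : ∀ n ω, 0 < σhat n ω)
    (h3 : TendstoInProb P (fun n ω => σhat n ω / a n) 1)
    (Ahat : ℕ → Ω → ℝ)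
    (h4 : TendstoInProb P (fun n ω => Ahat n ω / A n) 1)
    (Khat : ℕ → Ω → ℝ) (h5 : TendstoInProb P Khat (Kfun ξ ρ β))
    (Vhat : ℕ → Ω → ℝ) (hVpos : ∀ n ω, 0 < Vhat n ω)
    (h6 : TendstoInProb P Vhat V) :
    TendstoInDistGaussian P
      (fun n ω =>
        Real.sqrt (k n) * ((chat n ω - σhat n ω * Ahat n ω * Khat n ω) - c n ω) /
          (σhat n ω * Real.sqrt (Vhat n ω)))
      0 1 := by
  intro x
  have hcont : ContinuousAt (fun y => (gaussianReal 0 V.toNNReal (Set.Iic y)).toReal) (√V * x) :=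
    (continuous_gaussianReal_Iic (Real.toNNReal_pos.2 hV).ne').continuousAt
  have hbias : Tendsto (fun p : ℕ × Ω => √(k p.1) * A p.1 *
      (eps p.1 p.2 / (a p.1 * A p.1) -
        σhat p.1 p.2 / a p.1 * (Ahat p.1 p.2 / A p.1) * Khat p.1 p.2)) (probFilter P) (𝓝 0) := by
    simpa using (hlam.comp (tendsto_fst_probFilter P)).mul (h2.tendsto_probFilter.sub
      ((h3.tendsto_probFilter.mul h4.tendsto_probFilter).mul h5.tendsto_probFilter))
  have hscale : Tendsto (fun p : ℕ × Ω => σhat p.1 p.2 / a p.1 * √(Vhat p.1 p.2) * x)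
      (probFilter P) (𝓝 (√V * x)) := by
    simpa using (h3.tendsto_probFilter.mul h6.tendsto_probFilter.sqrt).mul_const x
  have hthreshold := hscale.sub hbias
  rw [sub_zero] at hthreshold
  have hlim := tendsto_measure_le_of_tendsto_probFilter
    (Y := fun n ω => σhat n ω / a n * √(Vhat n ω) * x - √(k n) * A n *
      (eps n ω / (a n * A n) - σhat n ω / a n * (Ahat n ω / A n) * Khat n ω)) h1 hcont hthreshold
  rw [gaussianReal_Iic_sqrt_mul hV x] at hlim
  refine hlim.congr fun n => ?_
  congr 3
  ext ω
  have han := ha n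
  have hAn := hA n
  have hden : 0 < σhat n ω * √(Vhat n ω) := mul_pos (hσpos n ω) (Real.sqrt_pos.2 (hVpos n ω))
  have hbias_eq : √(k n) * A n *
      (eps n ω / (a n * A n) - σhat n ω / a n * (Ahat n ω / A n) * Khat n ω) =
      √(k n) * (cu n ω - c n ω - σhat n ω * Ahat n ω * Khat n ω) / a n := by
    rw [heps]
    field_simp
  rw [div_le_iff₀ hden, hbias_eq, le_sub_iff_add_le, ← mul_le_mul_iff_of_pos_right han]
  refine iff_of_eq (congrArg₂ (· ≤ ·) ?_ ?_)
  · field_simp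
    ring
  · field_simp
end

section
/- Let γ > 1 and let X be a random variable with the Fréchet cdf F_γ(x) = exp(−x^{−γ}) for x > 0 and F_γ(x) = 0 for x ≤ 0. Then X is integrable and for every α ∈ (0,1), CVaR_α(X) = (1−α)^{−1}[Γ((γ−1)/γ) − Γ((γ−1)/γ, −log α)], where Γ(s) is the gamma function and Γ(s, x) = ∫_x^∞ t^{s−1} e^{−t} dt is the upper incomplete gamma function. -/
open MeasureTheory ProbabilityTheory Filter

/-- The upper incomplete gamma function `Γ(s, x) = ∫_x^∞ t^{s-1} e^{-t} dt`. -/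
noncomputable def uGamma (s x : ℝ) : ℝ := ∫ t in Set.Ioi x, t ^ (s - 1) * Real.exp (-t)

/-- The quantile function of the Fréchet distribution. -/
lemma VaR_frechet {γ : ℝ} (hγ : 0 < γ) {F : ℝ → ℝ}
    (hF : ∀ x, F x = if 0 < x then Real.exp (-x ^ (-γ)) else 0) {p : ℝ} (hp0 : 0 < p)
    (hp1 : p < 1) : VaR F p = (-Real.log p) ^ (-1 / γ) := by
  have hL : 0 < -Real.log p := neg_pos.2 (Real.log_neg hp0 hp1)
  have hset : {x : ℝ | p ≤ F x} = Set.Ici ((-Real.log p) ^ (-1 / γ)) := by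
    ext x
    simp only [Set.mem_ofPred_eq, Set.mem_Ici, hF]
    split_ifs with hx
    · rw [← Real.log_le_iff_le_exp hp0, le_neg, neg_div, one_div,
        show -γ⁻¹ = (-γ)⁻¹ from (inv_neg).symm]
      exact (Real.rpow_inv_le_iff_of_neg hL hx (neg_lt_zero.2 hγ)).symm
    · have : 0 < (-Real.log p) ^ (-1 / γ) := Real.rpow_pos_of_pos hL _
      constructor <;> intro h <;> linarith
  rw [VaR, hset, csInf_Ici]

/-- The substitution `p = exp (-t)`. -/
lemma setIntegral_comp_neg_log (f : ℝ → ℝ) {α : ℝ} (hα : 0 < α) :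
    ∫ p in Set.Ioo α 1, f (-Real.log p) =
      ∫ t in Set.Ioo 0 (-Real.log α), f t * Real.exp (-t) := by
  have himage : (fun t : ℝ => Real.exp (-t)) '' Set.Ioo 0 (-Real.log α) = Set.Ioo α 1 := by
    ext p
    constructor
    · rintro ⟨t, ⟨h0, h1⟩, rfl⟩
      exact ⟨(Real.log_lt_iff_lt_exp hα).1 (by linarith), Real.exp_lt_one_iff.2 (by linarith)⟩
    · rintro ⟨h0, h1⟩
      have hp := hα.trans h0
      exact ⟨-Real.log p, ⟨neg_pos.2 (Real.log_neg hp h1), neg_lt_neg (Real.log_lt_log hα h0)⟩,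
        by simp [Real.exp_log hp]⟩
  have hderiv : ∀ t ∈ Set.Ioo 0 (-Real.log α), HasDerivWithinAt (fun t : ℝ => Real.exp (-t))
      (-Real.exp (-t)) (Set.Ioo 0 (-Real.log α)) t := fun t _ => by
    simpa using ((hasDerivAt_neg t).exp).hasDerivWithinAt
  have hinj : Set.InjOn (fun t : ℝ => Real.exp (-t)) (Set.Ioo 0 (-Real.log α)) :=
    fun a _ b _ h => neg_injective (Real.exp_injective h)
  rw [← himage, integral_image_eq_integral_abs_deriv_smul measurableSet_Ioo hderiv hinj]
  simp [Real.abs_exp, mul_comm]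

/-- The lower incomplete gamma integral as a difference of the complete and the upper one. -/
lemma setIntegral_Ioo_rpow_mul_exp_neg {s x : ℝ} (hs : 0 < s) (hx : 0 ≤ x) :
    ∫ t in Set.Ioo 0 x, t ^ (s - 1) * Real.exp (-t) = Real.Gamma s - uGamma s x := by
  have hint : IntegrableOn (fun t : ℝ => t ^ (s - 1) * Real.exp (-t)) (Set.Ioi 0) := by
    simpa only [mul_comm] using Real.GammaIntegral_convergent hs
  have hsplit := setIntegral_union (Set.Ioc_disjoint_Ioi le_rfl) measurableSet_Ioi
    (hint.mono_set (Set.Ioc_subset_Ioi_self : Set.Ioc 0 x ⊆ _))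
    (hint.mono_set (Set.Ioi_subset_Ioi hx))
  rw [Set.Ioc_union_Ioi_eq_Ioi hx] at hsplit
  rw [← integral_Ioc_eq_integral_Ioo, Real.Gamma_eq_integral hs, uGamma]
  simp only [mul_comm (Real.exp _)]
  linarith

/-- A random variable that is a.s. nonnegative and whose tail is bounded by `t ^ (-γ)`, with
`1 < γ`, is integrable. -/
lemma integrable_of_tail_le_rpow {Ω : Type*} [MeasurableSpace Ω] {P : Measure Ω}
    [IsProbabilityMeasure P] {γ : ℝ} (hγ : 1 < γ) {X : Ω → ℝ} (hX : Measurable X)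
    (hnn : 0 ≤ᵐ[P] X)
    (htail : ∀ t, 1 < t → P {ω | t < X ω} ≤ ENNReal.ofReal (t ^ (-γ))) : Integrable X P := by
  refine ⟨hX.aestronglyMeasurable, ?_⟩
  rw [hasFiniteIntegral_iff_ofReal hnn, lintegral_eq_lintegral_meas_lt P hnn hX.aemeasurable,
    ← Set.Ioc_union_Ioi_eq_Ioi (zero_le_one' ℝ)]
  refine (lintegral_union_le _ _ _).trans_lt (ENNReal.add_lt_top.2 ⟨?_, ?_⟩)
  · calc ∫⁻ t in Set.Ioc (0 : ℝ) 1, P {ω | t < X ω} ≤ ∫⁻ _ in Set.Ioc (0 : ℝ) 1, 1 :=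
          lintegral_mono fun _ => prob_le_one
      _ < ⊤ := by simp
  · have hint := integrableOn_Ioi_rpow_of_lt (neg_lt_neg hγ) zero_lt_one
    exact (setLIntegral_mono' measurableSet_Ioi fun t ht => htail t ht).trans_lt
      hint.lintegral_lt_top

/-- CVaR of the Fréchet distribution: for `γ > 1` and the Fréchet cdf
`F_γ(x) = exp(-x^{-γ})` for `x > 0` (and `0` otherwise), the random variable `X` is
integrable and for every `α ∈ (0,1)`,
`CVaR_α(X) = (1-α)⁻¹ [Γ((γ-1)/γ) - Γ((γ-1)/γ, -log α)]`. -/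
theorem frechet_cvar
    {Ω : Type*} [MeasurableSpace Ω] (P : Measure Ω) [IsProbabilityMeasure P]
    (γ : ℝ) (hγ : 1 < γ)
    (X : Ω → ℝ) (hXm : Measurable X)
    (F : ℝ → ℝ) (hFdef : ∀ x, F x = if 0 < x then Real.exp (-x ^ (-γ)) else 0)
    (hcdf : ∀ x, (P {ω | X ω ≤ x}).toReal = F x) :
    Integrable X P ∧
      ∀ α ∈ Set.Ioo (0 : ℝ) 1,
        CVaR F α =
          (1 - α)⁻¹ * (Real.Gamma ((γ - 1) / γ) - uGamma ((γ - 1) / γ) (-Real.log α)) := by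
  have hγ0 : 0 < γ := zero_lt_one.trans hγ
  refine ⟨integrable_of_tail_le_rpow hγ hXm ?_ fun t ht => ?_, fun α hα => ?_⟩
  · have hzero : P {ω | X ω ≤ 0} = 0 := by
      have h := hcdf 0
      rw [hFdef, if_neg (lt_irrefl _)] at h
      exact ((ENNReal.toReal_eq_zero_iff _).1 h).resolve_right (measure_ne_top _ _)
    refine measure_mono_null (fun ω hω => ?_) hzero
    exact (not_le.1 (show ¬ (0 : ℝ) ≤ X ω from hω)).le
  · have hcompl : {ω | t < X ω} = {ω | X ω ≤ t}ᶜ := by ext; simp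
    rw [← ENNReal.ofReal_toReal (measure_ne_top P {ω | t < X ω}), hcompl]
    apply ENNReal.ofReal_le_ofReal
    have h := probReal_compl_eq_one_sub (μ := P) (measurableSet_le hXm (measurable_const (a := t)))
    rw [measureReal_def, measureReal_def, hcdf, hFdef, if_pos (zero_lt_one.trans ht)] at h
    rw [h]
    linarith [Real.add_one_le_exp (-t ^ (-γ))]
  · have hs : (γ - 1) / γ - 1 = -1 / γ := by field_simp; ring
    rw [CVaR, one_div, ← setIntegral_Ioo_rpow_mul_exp_neg (div_pos (sub_pos.2 hγ) hγ0)
      (neg_nonneg.2 (Real.log_nonpos hα.1.le hα.2.le)), hs,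
      ← setIntegral_comp_neg_log (fun t => t ^ (-1 / γ)) hα.1]
    congr 1
    exact setIntegral_congr_fun measurableSet_Ioo fun p hp =>
      VaR_frechet hγ0 hFdef (hα.1.trans hp.1) hp.2
end
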